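/- arXiv:1104.1261 — 4 statements merged into one kernel-verified Lean document; each statement's English description precedes it below -/
import Mathlib

section
/- Let B be a strictly convex Banach space, let Γ be a group generated by a finite symmetric subset K with a weight m on K, and let π be a linear isometric action of Γ on B with no nonzero fixed vector. Then the following are equivalent: (1) there is a constant C' > 0 such that every v ∈ B satisfies max_{γ∈K} ‖π(γ)v − v‖ ≥ C'‖v‖; (2) there is a constant C > 0 such that every v ∈ B \ {0} satisfies |∇₋F_{π,∞}|(v) ≥ C. -/
open Filter Topology

/-- Displacement function `F_{α,∞}(v) = max_{γ∈K} ‖α(γ)v - v‖`. -/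
noncomputable def dispInf {Γ B : Type*} [NormedAddCommGroup B] (K : Finset Γ)
    (hKne : K.Nonempty) (α : Γ → B → B) (v : B) : ℝ :=
  K.sup' hKne fun γ => ‖α γ v - v‖

/-- The absolute gradient `|∇₋F|(v) = max{limsup_{u→v, u≠v} (F v - F u)/‖v-u‖, 0}`. -/
noncomputable def absGrad {B : Type*} [NormedAddCommGroup B] (F : B → ℝ) (v : B) : ℝ :=
  max (Filter.limsup (fun u => (F v - F u) / ‖v - u‖) (𝓝[≠] v)) 0

/-- Ekeland's variational principle for a continuous nonnegative function. -/
theorem exists_strict_ekeland_point {X : Type*} [MetricSpace X] [CompleteSpace X] {F : X → ℝ}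
    (hF : Continuous F) (hF0 : ∀ x, 0 ≤ F x) {c : ℝ} (hc : 0 < c) (x₀ : X) :
    ∃ w, F w + c * dist w x₀ ≤ F x₀ ∧ ∀ u, F u + c * dist u w ≤ F w → u = w := by
  have trans : ∀ x y z, F y + c * dist y x ≤ F x → F z + c * dist z y ≤ F y →
      F z + c * dist z x ≤ F x := fun x y z hxy hyz => by
    nlinarith [dist_triangle z y x]
  have step : ∀ (n : ℕ) (x : X), ∃ y, F y + c * dist y x ≤ F x ∧
      ∀ z, F z + c * dist z x ≤ F x → F y ≤ F z + 1 / ((n : ℝ) + 1) := by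
    intro n x
    let S : Set ℝ := F '' {y | F y + c * dist y x ≤ F x}
    have hS : S.Nonempty := ⟨F x, x, by simp, rfl⟩
    have hbdd : BddBelow S := ⟨0, by rintro _ ⟨y, -, rfl⟩; exact hF0 y⟩
    obtain ⟨_, ⟨y, hy, rfl⟩, hlt⟩ := Real.lt_sInf_add_pos hS (Nat.one_div_pos_of_nat (n := n))
    refine ⟨y, hy, fun z hz => hlt.le.trans ?_⟩
    gcongr
    exact csInf_le hbdd ⟨z, hz, rfl⟩
  choose g hg hgmin using step
  let x : ℕ → X := fun n => Nat.rec x₀ g n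
  have hx : ∀ n k, F (x (n + k)) + c * dist (x (n + k)) (x n) ≤ F (x n) := by
    intro n k
    induction k with
    | zero => simp
    | succ k ih => exact trans _ _ _ ih (hg (n + k) (x (n + k)))
  have hanti : Antitone fun n => F (x n) := antitone_nat_of_succ_le fun n => by
    nlinarith [hx n 1, dist_nonneg (x := x (n + 1)) (y := x n)]
  have hbdd : BddBelow (Set.range fun n => F (x n)) :=
    ⟨0, by rintro _ ⟨n, rfl⟩; exact hF0 _⟩
  have hlim := tendsto_atTop_ciInf hanti hbdd
  set L := ⨅ n, F (x n)
  have hcauchy : CauchySeq x := by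
    refine cauchySeq_of_le_tendsto_0' (fun n => (F (x n) - L) / c) (fun n k hnk => ?_) ?_
    · obtain ⟨k, rfl⟩ := Nat.exists_eq_add_of_le hnk
      rw [le_div_iff₀ hc, dist_comm]
      linarith [hx n k, show L ≤ F (x (n + k)) from ciInf_le hbdd (n + k)]
    · simpa using (hlim.sub_const L).div_const c
  obtain ⟨w, hw⟩ := cauchySeq_tendsto_of_complete hcauchy
  have hFw : Tendsto (fun n => F (x n)) atTop (𝓝 (F w)) := (hF.tendsto w).comp hw
  have hxw : ∀ n, F w + c * dist w (x n) ≤ F (x n) := fun n => by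
    refine le_of_tendsto (hFw.add ((hw.dist tendsto_const_nhds).const_mul c)) ?_
    filter_upwards [eventually_ge_atTop n] with k hk
    obtain ⟨k, rfl⟩ := Nat.exists_eq_add_of_le hk
    exact hx n k
  refine ⟨w, hxw 0, fun u hu => ?_⟩
  have hwu : F w ≤ F u := by
    have hright := (tendsto_one_div_add_atTop_nhds_zero_nat (𝕜 := ℝ)).const_add (F u)
    rw [add_zero] at hright
    exact le_of_tendsto_of_tendsto' (hFw.comp (tendsto_add_atTop_nat 1)) hright
      fun n => hgmin n (x n) u (trans _ _ _ (hxw n) hu)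
  exact dist_le_zero.1 (by nlinarith)

section AbsGrad

variable {B : Type*} [NormedAddCommGroup B] {F : B → ℝ} {A : ℝ}

theorem abs_slope_le (hF : ∀ v u, |F v - F u| ≤ A * ‖v - u‖) {v u : B} (hu : u ≠ v) :
    |(F v - F u) / ‖v - u‖| ≤ A := by
  rw [abs_div, abs_norm, div_le_iff₀ (norm_sub_pos_iff.2 hu.symm)]
  exact hF v u

theorem absGrad_le_of_forall_le [NormedSpace ℝ B] (hF : ∀ v u, |F v - F u| ≤ A * ‖v - u‖)
    {c : ℝ} (hc : 0 ≤ c) {v : B} (hv : v ≠ 0) (h : ∀ u, u ≠ v → F v - F u ≤ c * ‖v - u‖) :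
    absGrad F v ≤ c := by
  have : Nontrivial B := ⟨v, 0, hv⟩
  have : (𝓝[≠] v).NeBot := Module.punctured_nhds_neBot ℝ B v
  refine max_le (limsup_le_of_le (isCoboundedUnder_le_of_eventually_le _ (x := -A) ?_) ?_) hc
  · filter_upwards [self_mem_nhdsWithin] with u hu using (abs_le.1 (abs_slope_le hF hu)).1
  · filter_upwards [self_mem_nhdsWithin] with u hu
    rw [div_le_iff₀ (norm_sub_pos_iff.2 (Ne.symm hu))]
    exact h u hu

/-- Moving towards the origin bounds the gradient of a positively homogeneous function below. -/
theorem div_norm_le_absGrad [NormedSpace ℝ B] (hF : ∀ v u, |F v - F u| ≤ A * ‖v - u‖)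
    (hhom : ∀ (t : ℝ) v, 0 ≤ t → F (t • v) = t * F v) {v : B} (hv : v ≠ 0) :
    F v / ‖v‖ ≤ absGrad F v := by
  refine le_max_of_le_left (le_limsup_of_frequently_le ?_ ?_)
  · have hlim : Tendsto (fun t : ℝ => (1 - t) • v) (𝓝[>] 0) (𝓝[≠] v) := by
      refine tendsto_nhdsWithin_iff.2 ⟨?_, ?_⟩
      · have : Continuous fun t : ℝ => (1 - t) • v := by fun_prop
        simpa using (this.tendsto 0).mono_left nhdsWithin_le_nhds
      · filter_upwards [self_mem_nhdsWithin] with t ht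
        simpa [sub_smul, hv] using (show (0 : ℝ) < t from ht).ne'
    refine hlim.frequently (Eventually.frequently ?_)
    filter_upwards [Ioo_mem_nhdsGT (zero_lt_one' ℝ)] with t ht
    have hvt : v - (1 - t) • v = t • v := by rw [sub_smul, one_smul, sub_sub_cancel]
    have hFt : F v - F ((1 - t) • v) = t * F v := by rw [hhom _ _ (by linarith [ht.2])]; ring
    rw [hvt, hFt, norm_smul, Real.norm_of_nonneg ht.1.le, mul_div_mul_left _ _ ht.1.ne']
  · refine ⟨A, eventually_map.2 ?_⟩
    filter_upwards [self_mem_nhdsWithin] with u hu using (abs_le.1 (abs_slope_le hF hu)).2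

/-- A Lipschitz function whose gradient is bounded below off the origin grows linearly. -/
theorem mul_norm_le_of_lt_absGrad [NormedSpace ℝ B] [CompleteSpace B]
    (hF : ∀ v u, |F v - F u| ≤ A * ‖v - u‖) (hF0 : ∀ v, 0 ≤ F v) {c : ℝ} (hc : 0 < c)
    (h : ∀ v, v ≠ 0 → c < absGrad F v) (v : B) : c * ‖v‖ ≤ F v := by
  have hcont : Continuous F := (LipschitzWith.of_dist_le' fun v u => by
    rw [Real.dist_eq, dist_eq_norm]; exact hF v u).continuous
  obtain ⟨w, hwv, hw⟩ := exists_strict_ekeland_point hcont hF0 hc v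
  obtain rfl : w = 0 := by
    by_contra hw0
    refine (h w hw0).not_ge (absGrad_le_of_forall_le hF hc.le hw0 fun u hu => ?_)
    by_contra! hlt
    refine hu (hw u ?_)
    rw [dist_comm, dist_eq_norm]
    linarith
  rw [dist_zero_left] at hwv
  linarith [hF0 0]

end AbsGrad

section Displacement

variable {Γ B : Type*} [NormedAddCommGroup B] [NormedSpace ℝ B] (K : Finset Γ)
  (hK : K.Nonempty) (π : Γ → B ≃ₗᵢ[ℝ] B)

theorem dispInf_nonneg (v : B) : 0 ≤ dispInf K hK (fun γ w => π γ w) v :=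
  (norm_nonneg _).trans (Finset.le_sup' (fun γ => ‖π γ v - v‖) hK.choose_spec)

theorem dispInf_le_add (v u : B) : dispInf K hK (fun γ w => π γ w) v ≤
    dispInf K hK (fun γ w => π γ w) u + 2 * ‖v - u‖ := by
  refine Finset.sup'_le hK _ fun γ hγ => ?_
  have hle : ‖π γ u - u‖ ≤ dispInf K hK (fun γ w => π γ w) u :=
    Finset.le_sup' (fun γ => ‖π γ u - u‖) hγ
  have hsplit : π γ v - v = (π γ u - u) + (π γ (v - u) - (v - u)) := by
    rw [map_sub]; abel
  have hdiff := norm_sub_le (π γ (v - u)) (v - u)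
  rw [LinearIsometryEquiv.norm_map] at hdiff
  change ‖π γ v - v‖ ≤ _
  rw [hsplit]
  linarith [norm_add_le (π γ u - u) (π γ (v - u) - (v - u))]

theorem abs_dispInf_sub_le (v u : B) : |dispInf K hK (fun γ w => π γ w) v -
    dispInf K hK (fun γ w => π γ w) u| ≤ 2 * ‖v - u‖ := by
  have := dispInf_le_add K hK π u v
  rw [norm_sub_rev] at this
  exact abs_sub_le_iff.2 ⟨by linarith [dispInf_le_add K hK π v u], by linarith⟩

theorem dispInf_smul (t : ℝ) (v : B) (ht : 0 ≤ t) : dispInf K hK (fun γ w => π γ w) (t • v) =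
    t * dispInf K hK (fun γ w => π γ w) v := by
  simp only [dispInf, map_smul, ← smul_sub, norm_smul, Real.norm_of_nonneg ht]
  exact (Finset.mul₀_sup' ht _ K hK).symm

end Displacement

theorem stmt1 {B : Type*} [NormedAddCommGroup B] [NormedSpace ℝ B] [CompleteSpace B]
    -- `B` is strictly convex:
    (hB : ∀ v u : B, v ≠ u → ‖v‖ ≤ 1 → ‖u‖ ≤ 1 → ‖v + u‖ < 2)
    {Γ : Type*} [Group Γ] (K : Finset Γ) (hKne : K.Nonempty)
    (hKsym : ∀ γ ∈ K, γ⁻¹ ∈ K)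
    (hKgen : Subgroup.closure (K : Set Γ) = ⊤)
    (m : Γ → ℝ) (hmpos : ∀ γ ∈ K, 0 < m γ) (hmsum : ∑ γ ∈ K, m γ = 1)
    -- `π` is a linear isometric action with no nonzero fixed vector:
    (π : Γ →* (B ≃ₗᵢ[ℝ] B)) (hπ : ∀ v : B, (∀ γ : Γ, π γ v = v) → v = 0) :
    (∃ C' > (0 : ℝ), ∀ v : B, C' * ‖v‖ ≤ K.sup' hKne fun γ => ‖π γ v - v‖) ↔
      (∃ C > (0 : ℝ), ∀ v : B, v ≠ 0 →
        C ≤ absGrad (dispInf K hKne (fun γ w => π γ w)) v) := by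
  constructor
  · rintro ⟨C, hC, h⟩
    refine ⟨C, hC, fun v hv => le_trans ?_ (div_norm_le_absGrad
      (abs_dispInf_sub_le K hKne π) (dispInf_smul K hKne π) hv)⟩
    rw [le_div_iff₀ (norm_pos_iff.2 hv)]
    exact h v
  · rintro ⟨C, hC, h⟩
    exact ⟨C / 2, half_pos hC, mul_norm_le_of_lt_absGrad (abs_dispInf_sub_le K hKne π)
      (dispInf_nonneg K hKne π) (half_pos hC) fun v hv => (half_lt_self hC).trans_le (h v hv)⟩
end

section
/- Let B be a strictly convex Banach space, let Γ be a group generated by a finite symmetric subset K with a weight m on K, and let π be a linear isometric action of Γ on B with no nonzero fixed vector. Then the following are equivalent: (1) every affine isometric action α ∈ A(π) has a fixed point; (2) for every α ∈ A(π) there is a constant C > 0 such that every v ∈ B with F_{α,∞}(v) > 0 satisfies |∇₋F_{α,∞}|(v) ≥ C. -/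
open Filter Topology

/-- A weak form of Ekeland's variational principle: a nonnegative continuous function on a
complete metric space has a point from which no descent of slope at least `ε` is possible. -/
theorem exists_forall_eq_of_mul_dist_le {X : Type*} [MetricSpace X] [CompleteSpace X] [Nonempty X]
    {F : X → ℝ} (hF : Continuous F) (hF0 : ∀ x, 0 ≤ F x) {ε : ℝ} (hε : 0 < ε) :
    ∃ x, ∀ u, ε * dist x u ≤ F x - F u → u = x := by
  have step : ∀ v, ∃ u, ε * dist v u ≤ F v - F u ∧
      ∀ w, ε * dist v w ≤ F v - F w → F u ≤ (F v + F w) / 2 := by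
    intro v
    by_contra! H
    set S := F '' {u | ε * dist v u ≤ F v - F u} with hS
    have hv : ε * dist v v ≤ F v - F v := by simp
    have hne : S.Nonempty := ⟨F v, v, hv, rfl⟩
    have hbdd : BddBelow S := ⟨0, by rintro _ ⟨u, -, rfl⟩; exact hF0 u⟩
    obtain ⟨w, hw, hw'⟩ := H v hv
    have hIw : sInf S ≤ F w := csInf_le hbdd ⟨w, hw, rfl⟩
    obtain ⟨_, ⟨u, hu, rfl⟩, hu'⟩ :=
      exists_lt_of_csInf_lt hne (show sInf S < (F v + sInf S) / 2 by linarith)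
    obtain ⟨z, hz, hz'⟩ := H u hu
    have hIz : sInf S ≤ F z := csInf_le hbdd ⟨z, hz, rfl⟩
    linarith
  choose g hg hg' using step
  have trans : ∀ {x y z : X}, ε * dist x y ≤ F x - F y → ε * dist y z ≤ F y - F z →
      ε * dist x z ≤ F x - F z := by
    intro x y z hxy hyz
    have := mul_le_mul_of_nonneg_left (dist_triangle x y z) hε.le
    linarith
  obtain ⟨x₀⟩ := ‹Nonempty X›
  set x : ℕ → X := fun n => g^[n] x₀ with hx
  have hsucc : ∀ n, x (n + 1) = g (x n) := fun n => Function.iterate_succ_apply' g n x₀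
  have hle : ∀ n k, ε * dist (x n) (x (n + k)) ≤ F (x n) - F (x (n + k)) := by
    intro n k
    induction k with
    | zero => simp
    | succ k ih =>
      refine trans ih ?_
      rw [← add_assoc, hsucc]
      exact hg _
  have hanti : Antitone fun n => F (x n) := by
    refine antitone_nat_of_succ_le fun n => ?_
    have := hle n 1
    have := mul_nonneg hε.le (dist_nonneg (x := x n) (y := x (n + 1)))
    linarith
  have hlim := tendsto_atTop_ciInf hanti ⟨0, by rintro _ ⟨n, rfl⟩; exact hF0 _⟩
  set L := ⨅ n, F (x n) with hL
  have hLle : ∀ n, L ≤ F (x n) := fun n => hanti.le_of_tendsto hlim n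
  have hcau : CauchySeq x := by
    refine cauchySeq_of_le_tendsto_0' (fun n => (F (x n) - L) / ε) ?_ ?_
    · intro n k hnk
      obtain ⟨k, rfl⟩ := Nat.exists_eq_add_of_le hnk
      rw [le_div_iff₀ hε]
      linarith [hle n k, hLle (n + k), mul_comm ε (dist (x n) (x (n + k)))]
    · simpa using (hlim.sub_const L).div_const ε
  obtain ⟨y, hy⟩ := cauchySeq_tendsto_of_complete hcau
  have hFy : F y = L := tendsto_nhds_unique ((hF.tendsto y).comp hy) hlim
  have hxy : ∀ n, ε * dist (x n) y ≤ F (x n) - F y := by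
    intro n
    have hy' : Tendsto (fun k => x (n + k)) atTop (𝓝 y) := by
      simpa [add_comm] using (tendsto_add_atTop_iff_nat n).2 hy
    exact le_of_tendsto_of_tendsto' ((tendsto_const_nhds.dist hy').const_mul ε)
      (((hF.tendsto y).comp hy').const_sub (F (x n))) (hle n)
  refine ⟨y, fun u hu => ?_⟩
  have h2 : ∀ n, F (x (n + 1)) ≤ (F (x n) + F u) / 2 := by
    intro n
    rw [hsucc]
    exact hg' _ _ (trans (hxy n) hu)
  have h3 : L ≤ (L + F u) / 2 :=
    le_of_tendsto_of_tendsto' ((tendsto_add_atTop_iff_nat 1).2 hlim)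
      ((hlim.add_const (F u)).div_const 2) h2
  have h4 : dist y u ≤ 0 := by
    by_contra! h
    have := mul_pos hε h
    linarith
  exact (dist_le_zero.1 h4).symm

section Displacement

variable {Γ B : Type*} [NormedAddCommGroup B]

theorem dispInf_nonneg_s3 (K : Finset Γ) (hKne : K.Nonempty) (α : Γ → B → B) (v : B) :
    0 ≤ dispInf K hKne α v := by
  obtain ⟨γ, hγ⟩ := hKne
  exact (norm_nonneg _).trans (Finset.le_sup' (fun γ => ‖α γ v - v‖) hγ)

theorem dispInf_sub_le (K : Finset Γ) (hKne : K.Nonempty) {α : Γ → B → B}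
    (hα : ∀ γ, Isometry (α γ)) (v u : B) :
    dispInf K hKne α v - dispInf K hKne α u ≤ 2 * ‖v - u‖ := by
  rw [sub_le_iff_le_add]
  refine Finset.sup'_le _ _ fun γ hγ => ?_
  have h1 : ‖α γ u - u‖ ≤ dispInf K hKne α u := Finset.le_sup' (fun γ => ‖α γ u - u‖) hγ
  have h2 : ‖α γ v - α γ u‖ = ‖v - u‖ := by
    rw [← dist_eq_norm, (hα γ).dist_eq, dist_eq_norm]
  have h3 : α γ v - v = (α γ v - α γ u) + (α γ u - u) - (v - u) := by abel
  have h4 := norm_sub_le ((α γ v - α γ u) + (α γ u - u)) (v - u)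
  have h5 := norm_add_le (α γ v - α γ u) (α γ u - u)
  rw [h3]
  linarith

theorem continuous_dispInf (K : Finset Γ) (hKne : K.Nonempty) {α : Γ → B → B}
    (hα : ∀ γ, Isometry (α γ)) : Continuous (dispInf K hKne α) := by
  refine (LipschitzWith.of_le_add_mul 2 fun v u => ?_).continuous
  have := dispInf_sub_le K hKne hα v u
  rw [dist_eq_norm]
  push_cast
  linarith

end Displacement

section AbsGrad

variable {B : Type*} [NormedAddCommGroup B]

theorem div_norm_sub_le {F : B → ℝ} {M : ℝ} (hM : 0 ≤ M)
    (hF : ∀ v u, F v - F u ≤ M * ‖v - u‖) (v u : B) : (F v - F u) / ‖v - u‖ ≤ M :=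
  div_le_of_le_mul₀ (norm_nonneg _) hM (hF v u)

theorem neg_le_div_norm_sub {F : B → ℝ} {M : ℝ} (hM : 0 ≤ M)
    (hF : ∀ v u, F v - F u ≤ M * ‖v - u‖) (v u : B) : -M ≤ (F v - F u) / ‖v - u‖ := by
  have h := div_norm_sub_le hM hF u v
  rw [norm_sub_rev, ← neg_sub (F v), neg_div] at h
  linarith

/-- A point where the absolute gradient of a Lipschitz function exceeds `ε` admits a strict
descent with slope at least `ε`. -/
theorem exists_mul_norm_le_of_lt_absGrad [NormedSpace ℝ B] [Nontrivial B] {F : B → ℝ} {M : ℝ}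
    (hM : 0 ≤ M) (hF : ∀ v u, F v - F u ≤ M * ‖v - u‖) {ε : ℝ} (hε : 0 ≤ ε) {v : B}
    (h : ε < absGrad F v) : ∃ u ≠ v, ε * ‖v - u‖ ≤ F v - F u := by
  have hlim : ε < limsup (fun u => (F v - F u) / ‖v - u‖) (𝓝[≠] v) :=
    (lt_max_iff.1 h).resolve_right hε.not_gt
  have : (𝓝[≠] v).NeBot := Module.punctured_nhds_neBot ℝ B v
  have hcob : IsCoboundedUnder (· ≤ ·) (𝓝[≠] v) (fun u => (F v - F u) / ‖v - u‖) :=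
    IsBoundedUnder.isCoboundedUnder_le
      ⟨-M, eventually_map.2 (Eventually.of_forall (neg_le_div_norm_sub hM hF v))⟩
  obtain ⟨u, hu, huv⟩ :=
    ((frequently_lt_of_lt_limsup hcob hlim).and_eventually self_mem_nhdsWithin).exists
  have huv : u ≠ v := huv
  refine ⟨u, huv, ?_⟩
  exact ((lt_div_iff₀ (norm_pos_iff.2 (sub_ne_zero.2 huv.symm))).1 hu).le

theorem le_absGrad_of_segment [NormedSpace ℝ B] {F : B → ℝ} {M : ℝ} (hM : 0 ≤ M)
    (hF : ∀ v u, F v - F u ≤ M * ‖v - u‖) {C : ℝ} {v v₀ : B} (hv : v ≠ v₀)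
    (h : ∀ t ∈ Set.Ioo (0 : ℝ) 1,
      C * (t * ‖v - v₀‖) ≤ F v - F (v - t • (v - v₀))) : C ≤ absGrad F v := by
  refine le_max_of_le_left (le_limsup_of_frequently_le ?_
    ⟨M, eventually_map.2 (Eventually.of_forall (div_norm_sub_le hM hF v))⟩)
  have hv' : v - v₀ ≠ 0 := sub_ne_zero.2 hv
  have htend : Tendsto (fun t : ℝ => v - t • (v - v₀)) (𝓝[>] 0) (𝓝[≠] v) := by
    refine tendsto_nhdsWithin_iff.2 ⟨?_, ?_⟩
    · have : Continuous fun t : ℝ => v - t • (v - v₀) := by fun_prop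
      simpa using (this.tendsto 0).mono_left nhdsWithin_le_nhds
    · filter_upwards [self_mem_nhdsWithin] with t ht
      have ht : (0 : ℝ) < t := ht
      simpa [ht.ne'] using hv'
  refine htend.frequently (Eventually.frequently ?_)
  filter_upwards [Ioo_mem_nhdsGT (zero_lt_one' ℝ)] with t ht
  have hn : ‖v - (v - t • (v - v₀))‖ = t * ‖v - v₀‖ := by
    rw [sub_sub_cancel, norm_smul, Real.norm_of_nonneg ht.1.le]
  rw [hn, le_div_iff₀ (mul_pos ht.1 (norm_pos_iff.2 hv'))]
  exact h t ht

end AbsGrad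

section Cocycle

variable {Γ B : Type*} [Group Γ] [NormedAddCommGroup B] [NormedSpace ℝ B]

theorem isometricAction_mul (π : Γ →* (B ≃ₗᵢ[ℝ] B)) (x y : Γ) (w : B) :
    π (x * y) w = π x (π y w) := by
  rw [map_mul]
  rfl

theorem isometricAction_one (π : Γ →* (B ≃ₗᵢ[ℝ] B)) (w : B) : π 1 w = w := by
  rw [map_one]
  rfl

theorem fixed_of_fixed_on_generators {K : Set Γ} (hK : Subgroup.closure K = ⊤)
    {π : Γ →* (B ≃ₗᵢ[ℝ] B)} {c : Γ → B} (hc : ∀ γ γ' : Γ, c (γ * γ') = π γ (c γ') + c γ) {v : B}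
    (hv : ∀ γ ∈ K, π γ v + c γ = v) (γ : Γ) : π γ v + c γ = v := by
  have hc1 : c 1 = 0 := by simpa using hc 1 1
  have hγ : γ ∈ Subgroup.closure K := hK ▸ Subgroup.mem_top γ
  induction hγ using Subgroup.closure_induction with
  | mem x hx => exact hv x hx
  | one => simp [hc1]
  | mul x y _ _ hx hy =>
    rw [hc, isometricAction_mul, ← add_assoc, ← map_add, hy, hx]
  | inv x _ hx =>
    have h := hc x⁻¹ x
    rw [inv_mul_cancel, hc1] at h
    conv_lhs => rw [← hx, map_add, add_assoc, ← h, add_zero, ← isometricAction_mul,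
      inv_mul_cancel, isometricAction_one]

/-- The coboundary map `v ↦ (v - π γ v)_{γ ∈ K}`. -/
noncomputable def coboundary (K : Finset Γ) (π : Γ →* (B ≃ₗᵢ[ℝ] B)) : B →L[ℝ] (K → B) :=
  ContinuousLinearMap.pi fun γ =>
    ContinuousLinearMap.id ℝ B - ((π γ).toContinuousLinearEquiv : B →L[ℝ] B)

theorem coboundary_apply (K : Finset Γ) (π : Γ →* (B ≃ₗᵢ[ℝ] B)) (v : B) (γ : K) :
    coboundary K π v γ = v - π γ v := rfl

theorem norm_coboundary_le (K : Finset Γ) (hKne : K.Nonempty) (π : Γ →* (B ≃ₗᵢ[ℝ] B)) (v : B) :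
    ‖coboundary K π v‖ ≤ dispInf K hKne (fun γ w => π γ w) v := by
  refine (pi_norm_le_iff_of_nonneg (dispInf_nonneg_s3 _ _ _ _)).2 fun γ => ?_
  rw [coboundary_apply, norm_sub_rev]
  exact Finset.le_sup' (fun γ => ‖π γ v - v‖) γ.2

/-- If every affine action with linear part `π` has a fixed point, the coboundaries are closed. -/
theorem isClosed_range_coboundary [CompleteSpace B] (K : Finset Γ)
    (hKgen : Subgroup.closure (K : Set Γ) = ⊤) (π : Γ →* (B ≃ₗᵢ[ℝ] B))
    (hfix : ∀ c : Γ → B, (∀ γ γ' : Γ, c (γ * γ') = π γ (c γ') + c γ) →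
      ∃ v : B, ∀ γ : Γ, π γ v + c γ = v) : IsClosed (Set.range (coboundary K π)) := by
  refine isClosed_of_closure_subset fun f hf => ?_
  obtain ⟨y, hy, hyf⟩ := mem_closure_iff_seq_limit.1 hf
  choose v hv using hy
  have hmul : ∀ x y w, w - π (x * y) w = π x (w - π y w) + (w - π x w) := by
    intro x y w
    rw [isometricAction_mul, map_sub]
    abel
  have hconv : ∀ γ, ∃ b, Tendsto (fun n => v n - π γ (v n)) atTop (𝓝 b) := by
    intro γ
    have hγ : γ ∈ Subgroup.closure (K : Set Γ) := hKgen ▸ Subgroup.mem_top γ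
    induction hγ using Subgroup.closure_induction with
    | mem x hx =>
      refine ⟨f ⟨x, hx⟩, (tendsto_pi_nhds.1 hyf ⟨x, hx⟩).congr fun n => ?_⟩
      rw [← hv, coboundary_apply]
    | one => exact ⟨0, by simp⟩
    | mul x y _ _ hx hy =>
      obtain ⟨a, ha⟩ := hx
      obtain ⟨b, hb⟩ := hy
      refine ⟨π x b + a, ((((π x).continuous.tendsto b).comp hb).add ha).congr fun n => ?_⟩
      exact (hmul x y (v n)).symm
    | inv x _ hx =>
      obtain ⟨a, ha⟩ := hx
      refine ⟨-π x⁻¹ a, (((π x⁻¹).continuous.tendsto a).comp ha).neg.congr fun n => ?_⟩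
      have h := hmul x⁻¹ x (v n)
      rw [inv_mul_cancel, isometricAction_one, sub_self] at h
      exact neg_eq_of_add_eq_zero_right h.symm
  choose c hc using hconv
  obtain ⟨w, hw⟩ := hfix c fun γ γ' => tendsto_nhds_unique (hc (γ * γ'))
    (((((π γ).continuous.tendsto _).comp (hc γ')).add (hc γ)).congr
      fun n => (hmul γ γ' (v n)).symm)
  refine ⟨w, funext fun γ => ?_⟩
  have hfγ : f γ = c γ := by
    refine tendsto_nhds_unique ((tendsto_pi_nhds.1 hyf γ).congr fun n => ?_) (hc γ)
    rw [← hv, coboundary_apply]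
  rw [coboundary_apply, hfγ, sub_eq_iff_eq_add', hw]

/-- Vanishing of the first cohomology gives a spectral gap. -/
theorem exists_mul_norm_le_dispInf [CompleteSpace B] (K : Finset Γ) (hKne : K.Nonempty)
    (hKgen : Subgroup.closure (K : Set Γ) = ⊤) (π : Γ →* (B ≃ₗᵢ[ℝ] B))
    (hπ : ∀ v : B, (∀ γ : Γ, π γ v = v) → v = 0)
    (hfix : ∀ c : Γ → B, (∀ γ γ' : Γ, c (γ * γ') = π γ (c γ') + c γ) →
      ∃ v : B, ∀ γ : Γ, π γ v + c γ = v) :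
    ∃ C > (0 : ℝ), ∀ v : B, C * ‖v‖ ≤ dispInf K hKne (fun γ w => π γ w) v := by
  have hinj : Function.Injective (coboundary K π) := by
    refine (injective_iff_map_eq_zero _).2 fun v hv => hπ v fun γ => ?_
    have h := fixed_of_fixed_on_generators hKgen (π := π) (c := 0) (v := v) (by simp)
      (fun γ hγ => ?_) γ
    · simpa using h
    · have := congrFun hv ⟨γ, hγ⟩
      rw [coboundary_apply, Pi.zero_apply, sub_eq_zero] at this
      simpa using this.symm
  obtain ⟨N, hN⟩ := (coboundary K π).antilipschitz_of_injective_of_isClosed_range hinj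
    (isClosed_range_coboundary K hKgen π hfix)
  have hpos : (0 : ℝ) < N + 1 := by positivity
  refine ⟨(N + 1 : ℝ)⁻¹, inv_pos.2 hpos, fun v => ?_⟩
  rw [inv_mul_le_iff₀ hpos]
  have h1 : ‖v‖ ≤ N * ‖coboundary K π v‖ := by simpa using hN.le_mul_dist v 0
  have h2 := norm_coboundary_le K hKne π v
  nlinarith [N.coe_nonneg, norm_nonneg (coboundary K π v)]

end Cocycle

/-- Affine isometric actions with linear part `π` correspond exactly to `π`-cocycles
`c : Γ → B` via `α(γ)v = π(γ)v + c(γ)`. -/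
theorem stmt3 {B : Type*} [NormedAddCommGroup B] [NormedSpace ℝ B] [CompleteSpace B]
    -- `B` is strictly convex:
    (hB : ∀ v u : B, v ≠ u → ‖v‖ ≤ 1 → ‖u‖ ≤ 1 → ‖v + u‖ < 2)
    {Γ : Type*} [Group Γ] (K : Finset Γ) (hKne : K.Nonempty)
    (hKsym : ∀ γ ∈ K, γ⁻¹ ∈ K)
    (hKgen : Subgroup.closure (K : Set Γ) = ⊤)
    (m : Γ → ℝ) (hmpos : ∀ γ ∈ K, 0 < m γ) (hmsum : ∑ γ ∈ K, m γ = 1)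
    -- `π` is a linear isometric action with no nonzero fixed vector:
    (π : Γ →* (B ≃ₗᵢ[ℝ] B)) (hπ : ∀ v : B, (∀ γ : Γ, π γ v = v) → v = 0) :
    -- (1) every affine isometric action with linear part `π` has a fixed point
    (∀ c : Γ → B, (∀ γ γ' : Γ, c (γ * γ') = π γ (c γ') + c γ) →
        ∃ v : B, ∀ γ : Γ, π γ v + c γ = v) ↔
      -- (2) for every such action the absolute gradient of `F_{α,∞}` is uniformly positive
      -- away from the zero set of `F_{α,∞}`
      (∀ c : Γ → B, (∀ γ γ' : Γ, c (γ * γ') = π γ (c γ') + c γ) →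
        ∃ C > (0 : ℝ), ∀ v : B,
          0 < dispInf K hKne (fun γ w => π γ w + c γ) v →
            C ≤ absGrad (dispInf K hKne (fun γ w => π γ w + c γ)) v) := by
  have hiso : ∀ (c : Γ → B) (γ : Γ), Isometry fun w => π γ w + c γ := fun c γ =>
    (isometry_add_right (c γ)).comp (π γ).isometry
  constructor
  · intro hfix c hc
    obtain ⟨C, hC, hgap⟩ := exists_mul_norm_le_dispInf K hKne hKgen π hπ hfix
    obtain ⟨v₀, hv₀⟩ := hfix c hc
    have hdisp : ∀ v, dispInf K hKne (fun γ w => π γ w + c γ) v =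
        dispInf K hKne (fun γ w => π γ w) (v - v₀) := by
      intro v
      refine Finset.sup'_congr hKne rfl fun γ _ => ?_
      congr 1
      have h : c γ = v₀ - π γ v₀ := eq_sub_of_add_eq' (hv₀ γ)
      beta_reduce
      rw [map_sub, h]
      abel
    have hsmul : ∀ (t : ℝ), 0 ≤ t → ∀ v, dispInf K hKne (fun γ w => π γ w) (t • v) ≤
        t * dispInf K hKne (fun γ w => π γ w) v := by
      intro t ht v
      refine Finset.sup'_le _ _ fun γ hγ => ?_
      beta_reduce
      rw [map_smul, ← smul_sub, norm_smul, Real.norm_of_nonneg ht]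
      exact mul_le_mul_of_nonneg_left (Finset.le_sup' (fun γ => ‖π γ v - v‖) hγ) ht
    refine ⟨C, hC, fun v hv => ?_⟩
    refine le_absGrad_of_segment zero_le_two (dispInf_sub_le K hKne (hiso c)) (v₀ := v₀) ?_ ?_
    · rintro rfl
      refine hv.not_ge (Finset.sup'_le _ _ fun γ _ => ?_)
      simp [hv₀]
    · intro t ht
      have h1 := hsmul (1 - t) (by linarith [ht.2]) (v - v₀)
      have h2 : v - t • (v - v₀) - v₀ = (1 - t) • (v - v₀) := by
        rw [sub_smul, one_smul]
        abel
      rw [hdisp, hdisp, h2]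
      have h3 := mul_le_mul_of_nonneg_left (hgap (v - v₀)) ht.1.le
      linarith
  · intro hgrad c hc
    obtain ⟨C, hC, hgrad⟩ := hgrad c hc
    have hlip := dispInf_sub_le K hKne (hiso c)
    obtain ⟨v, hv⟩ := exists_forall_eq_of_mul_dist_le (continuous_dispInf K hKne (hiso c))
      (dispInf_nonneg_s3 K hKne _) (half_pos hC)
    refine ⟨v, fixed_of_fixed_on_generators hKgen hc fun γ hγ => ?_⟩
    by_contra hne
    have hpos : 0 < dispInf K hKne (fun γ w => π γ w + c γ) v :=
      (norm_pos_iff.2 (sub_ne_zero.2 hne)).trans_le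
        (Finset.le_sup' (fun γ => ‖π γ v + c γ - v‖) hγ)
    have : Nontrivial B := ⟨_, _, hne⟩
    obtain ⟨u, huv, hu⟩ := exists_mul_norm_le_of_lt_absGrad zero_le_two hlip (half_pos hC).le
      ((half_lt_self hC).trans_le (hgrad v hpos))
    exact huv (hv u (by rwa [dist_eq_norm]))
end

section
/- Let B be a strictly convex Banach space, let Γ be a group generated by a finite symmetric subset K with a weight m on K, let π be a linear isometric action of Γ on B with no nonzero fixed vector, and let 1 ≤ r < ∞. If every affine isometric action α ∈ A(π) has a fixed point, then there exists a constant C > 0, independent of α, such that for every α ∈ A(π) and every v ∈ B with F_{α,r}(v) > 0 one has |∇₋F_{α,r}|(v) ≥ C. -/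
open Filter Topology

/-- Displacement function `F_{α,r}` (for `1 ≤ r < ∞`) of an action `α` with respect to a
finite generating set `K` and a weight `m`. -/
noncomputable def dispR {Γ B : Type*} [NormedAddCommGroup B] (K : Finset Γ) (m : Γ → ℝ)
    (α : Γ → B → B) (r : ℝ) (v : B) : ℝ :=
  (∑ γ ∈ K, ‖α γ v - v‖ ^ r * m γ) ^ (1 / r)

/-- The map `v ↦ (π γ v - v)_{γ ∈ K}`, the restriction to `K` of the coboundary map. -/
noncomputable def coboundaryOn {B : Type*} [NormedAddCommGroup B] [NormedSpace ℝ B]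
    {Γ : Type*} [Group Γ] (K : Finset Γ) (π : Γ →* (B ≃ₗᵢ[ℝ] B)) : B →L[ℝ] (K → B) :=
  ContinuousLinearMap.pi fun γ =>
    ((π γ.1).toContinuousLinearEquiv : B →L[ℝ] B) - ContinuousLinearMap.id ℝ B

@[simp]
theorem coboundaryOn_apply {B : Type*} [NormedAddCommGroup B] [NormedSpace ℝ B]
    {Γ : Type*} [Group Γ] (K : Finset Γ) (π : Γ →* (B ≃ₗᵢ[ℝ] B)) (v : B) (γ : K) :
    coboundaryOn K π v γ = π γ.1 v - v := rfl

theorem coboundaryOn_injective {B : Type*} [NormedAddCommGroup B] [NormedSpace ℝ B]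
    {Γ : Type*} [Group Γ] (K : Finset Γ) (hKgen : Subgroup.closure (K : Set Γ) = ⊤)
    (π : Γ →* (B ≃ₗᵢ[ℝ] B)) (hπ : ∀ v : B, (∀ γ : Γ, π γ v = v) → v = 0) :
    Function.Injective (coboundaryOn K π) := by
  rw [injective_iff_map_eq_zero]
  intro v hv
  apply hπ
  intro γ
  have hγ : γ ∈ Subgroup.closure (K : Set Γ) := hKgen ▸ Subgroup.mem_top γ
  induction hγ using Subgroup.closure_induction with
  | mem x hx => exact sub_eq_zero.mp (congrFun hv ⟨x, hx⟩)
  | one => simp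
  | mul x y _ _ hx hy => simp [hx, hy]
  | inv x _ hx =>
    have h : π x⁻¹ (π x v) = v := by simp
    rwa [hx] at h

theorem coboundaryOn_isClosed_range {B : Type*} [NormedAddCommGroup B] [NormedSpace ℝ B]
    {Γ : Type*} [Group Γ] (K : Finset Γ) (hKgen : Subgroup.closure (K : Set Γ) = ⊤)
    (π : Γ →* (B ≃ₗᵢ[ℝ] B))
    (hfix : ∀ c : Γ → B, (∀ γ γ' : Γ, c (γ * γ') = π γ (c γ') + c γ) →
      ∃ v : B, ∀ γ : Γ, π γ v + c γ = v) :
    IsClosed (Set.range (coboundaryOn K π)) := by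
  apply IsSeqClosed.isClosed
  intro y z hy hz
  choose v hv using hy
  have hlim : ∀ γ : Γ, ∃ b, Tendsto (fun n => π γ (v n) - v n) atTop (𝓝 b) := by
    intro γ
    have hγ : γ ∈ Subgroup.closure (K : Set Γ) := hKgen ▸ Subgroup.mem_top γ
    induction hγ using Subgroup.closure_induction with
    | mem x hx =>
      refine ⟨z ⟨x, hx⟩, ?_⟩
      have h := (tendsto_pi_nhds.mp hz) ⟨x, hx⟩
      simpa [← hv] using h
    | one => exact ⟨0, by simp⟩
    | mul x y _ _ hx hy =>
      obtain ⟨a, ha⟩ := hx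
      obtain ⟨b, hb⟩ := hy
      refine ⟨π x b + a, ((((π x).continuous.tendsto b).comp hb).add ha).congr fun n => ?_⟩
      simp
    | inv x _ hx =>
      obtain ⟨a, ha⟩ := hx
      refine ⟨-π x⁻¹ a, (((π x⁻¹).continuous.tendsto a).comp ha).neg.congr fun n => ?_⟩
      have h : π x⁻¹ (π x (v n)) = v n := by simp
      simp [-map_inv, h]
  choose c hc using hlim
  have hcoc : ∀ γ γ' : Γ, c (γ * γ') = π γ (c γ') + c γ := by
    intro x y
    refine tendsto_nhds_unique (hc (x * y))
      (((((π x).continuous.tendsto _).comp (hc y)).add (hc x)).congr fun n => ?_)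
    simp
  obtain ⟨x, hx⟩ := hfix c hcoc
  refine ⟨-x, funext fun γ => ?_⟩
  have h1 : z γ = c γ := by
    refine tendsto_nhds_unique ((tendsto_pi_nhds.mp hz) γ) ((hc γ).congr fun n => ?_)
    simp [← hv]
  rw [h1, coboundaryOn_apply, map_neg, eq_sub_iff_add_eq'.mpr (hx γ)]
  abel

theorem dispR_smul {Γ B : Type*} [NormedAddCommGroup B] [NormedSpace ℝ B] [Group Γ]
    (K : Finset Γ) (m : Γ → ℝ) (hm : ∀ γ ∈ K, 0 ≤ m γ) (π : Γ →* (B ≃ₗᵢ[ℝ] B))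
    {r : ℝ} (hr : 0 < r) {t : ℝ} (ht : 0 ≤ t) (w : B) :
    dispR K m (fun γ w => π γ w) r (t • w) = t * dispR K m (fun γ w => π γ w) r w := by
  unfold dispR
  have h : ∑ γ ∈ K, ‖π γ (t • w) - t • w‖ ^ r * m γ
      = t ^ r * ∑ γ ∈ K, ‖π γ w - w‖ ^ r * m γ := by
    rw [Finset.mul_sum]
    refine Finset.sum_congr rfl fun γ _ => ?_
    rw [map_smul, ← smul_sub, norm_smul, Real.norm_of_nonneg ht,
      Real.mul_rpow ht (norm_nonneg _), mul_assoc]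
  have h0 : 0 ≤ ∑ γ ∈ K, ‖π γ w - w‖ ^ r * m γ :=
    Finset.sum_nonneg fun γ hγ => mul_nonneg (by positivity) (hm γ hγ)
  rw [h, Real.mul_rpow (by positivity) h0, ← Real.rpow_mul ht, mul_one_div_cancel hr.ne',
    Real.rpow_one]

theorem dispR_add_le {Γ B : Type*} [NormedAddCommGroup B] [NormedSpace ℝ B] [Group Γ]
    (K : Finset Γ) (m : Γ → ℝ) (hm : ∀ γ ∈ K, 0 ≤ m γ) (π : Γ →* (B ≃ₗᵢ[ℝ] B))
    {r : ℝ} (hr : 1 ≤ r) (v w : B) :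
    dispR K m (fun γ w => π γ w) r (v + w) ≤
      dispR K m (fun γ w => π γ w) r v + dispR K m (fun γ w => π γ w) r w := by
  have hr0 : 0 < r := by linarith
  have key : ∀ x : Γ → ℝ, (∀ γ, 0 ≤ x γ) →
      ∑ γ ∈ K, x γ ^ r * m γ = ∑ γ ∈ K, (x γ * m γ ^ (1 / r)) ^ r := by
    intro x hx
    refine Finset.sum_congr rfl fun γ hγ => ?_
    have := hm γ hγ
    rw [Real.mul_rpow (hx γ) (by positivity), ← Real.rpow_mul this,
      one_div_mul_cancel hr0.ne', Real.rpow_one]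
  have hs := Real.Lp_add_le_of_nonneg K hr
    (f := fun γ => ‖π γ v - v‖ * m γ ^ (1 / r)) (g := fun γ => ‖π γ w - w‖ * m γ ^ (1 / r))
    (fun γ hγ => mul_nonneg (norm_nonneg _) (Real.rpow_nonneg (hm γ hγ) _))
    (fun γ hγ => mul_nonneg (norm_nonneg _) (Real.rpow_nonneg (hm γ hγ) _))
  unfold dispR
  rw [key _ fun γ => norm_nonneg (π γ v - v), key _ fun γ => norm_nonneg (π γ w - w)]
  refine le_trans (Real.rpow_le_rpow ?_ ?_ (by positivity)) hs
  · exact Finset.sum_nonneg fun γ hγ => mul_nonneg (by positivity) (hm γ hγ)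
  · rw [key _ fun γ => norm_nonneg (π γ (v + w) - (v + w))]
    refine Finset.sum_le_sum fun γ hγ => ?_
    have h0 := Real.rpow_nonneg (hm γ hγ) (1 / r)
    refine Real.rpow_le_rpow (by positivity) ?_ hr0.le
    rw [← add_mul]
    refine mul_le_mul_of_nonneg_right ?_ h0
    calc ‖π γ (v + w) - (v + w)‖ = ‖(π γ v - v) + (π γ w - w)‖ := by
          rw [map_add]; congr 1; abel
      _ ≤ _ := norm_add_le _ _

theorem dispR_le_two_mul_norm {Γ B : Type*} [NormedAddCommGroup B] [NormedSpace ℝ B] [Group Γ]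
    (K : Finset Γ) (m : Γ → ℝ) (hm : ∀ γ ∈ K, 0 ≤ m γ) (hmsum : ∑ γ ∈ K, m γ = 1)
    (π : Γ →* (B ≃ₗᵢ[ℝ] B)) {r : ℝ} (hr : 0 < r) (w : B) :
    dispR K m (fun γ w => π γ w) r w ≤ 2 * ‖w‖ := by
  have h : ∑ γ ∈ K, ‖π γ w - w‖ ^ r * m γ ≤ (2 * ‖w‖) ^ r := by
    rw [← mul_one ((2 * ‖w‖) ^ r), ← hmsum, Finset.mul_sum]
    refine Finset.sum_le_sum fun γ hγ => mul_le_mul_of_nonneg_right ?_ (hm γ hγ)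
    refine Real.rpow_le_rpow (norm_nonneg _) ?_ hr.le
    refine (norm_sub_le _ _).trans ?_
    rw [LinearIsometryEquiv.norm_map]; linarith
  refine (Real.rpow_le_rpow ?_ h (by positivity)).trans ?_
  · exact Finset.sum_nonneg fun γ hγ => mul_nonneg (by positivity) (hm γ hγ)
  · rw [← Real.rpow_mul (by positivity), mul_one_div_cancel hr.ne', Real.rpow_one]

theorem norm_mul_rpow_le_dispR {Γ B : Type*} [NormedAddCommGroup B]
    (K : Finset Γ) (m : Γ → ℝ) (hm : ∀ γ ∈ K, 0 ≤ m γ) (α : Γ → B → B)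
    {r : ℝ} (hr : 0 < r) (w : B) {γ : Γ} (hγ : γ ∈ K) :
    ‖α γ w - w‖ * m γ ^ (1 / r) ≤ dispR K m α r w := by
  have h := Finset.single_le_sum (f := fun γ => ‖α γ w - w‖ ^ r * m γ)
    (fun γ hγ => mul_nonneg (by positivity) (hm γ hγ)) hγ
  have h' := Real.rpow_le_rpow (mul_nonneg (by positivity) (hm γ hγ)) h
    (by positivity : 0 ≤ 1 / r)
  rwa [Real.mul_rpow (by positivity) (hm γ hγ), ← Real.rpow_mul (norm_nonneg _),
    mul_one_div_cancel hr.ne', Real.rpow_one] at h'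

/-- Moving from `v` towards a fixed point `x` decreases a displacement function at rate
`F v / ‖v - x‖`. -/
theorem div_le_absGrad {B : Type*} [NormedAddCommGroup B] [NormedSpace ℝ B] {F : B → ℝ}
    {L : ℝ} (hL : ∀ v u, F v - F u ≤ L * ‖v - u‖) {v x : B} (hvx : v ≠ x)
    (hF : ∀ t ∈ Set.Ioo (0 : ℝ) 1, F (v - t • (v - x)) = (1 - t) * F v) :
    F v / ‖v - x‖ ≤ absGrad F v := by
  refine le_max_of_le_left (le_limsup_of_frequently_le ?_ ?_)
  · have hne : v - x ≠ 0 := sub_ne_zero.mpr hvx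
    have ht : Tendsto (fun t : ℝ => v - t • (v - x)) (𝓝[>] 0) (𝓝[≠] v) := by
      refine tendsto_nhdsWithin_iff.mpr ⟨?_, ?_⟩
      · refine tendsto_nhdsWithin_of_tendsto_nhds ?_
        have : Continuous fun t : ℝ => v - t • (v - x) := by fun_prop
        simpa using this.tendsto 0
      · filter_upwards [self_mem_nhdsWithin] with t ht
        have ht' : t ≠ 0 := (Set.mem_Ioi.mp ht).ne'
        simp [ht', hne]
    refine ht.frequently (Eventually.frequently ?_)
    filter_upwards [Ioo_mem_nhdsGT (zero_lt_one' ℝ)] with t ht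
    have h0 : (0 : ℝ) < t := ht.1
    have hn : 0 < ‖v - x‖ := norm_pos_iff.mpr hne
    rw [hF t ht, sub_sub_cancel, norm_smul, Real.norm_of_nonneg h0.le]
    apply le_of_eq
    field_simp
    ring
  · refine isBoundedUnder_of_eventually_le (a := L) ?_
    filter_upwards [self_mem_nhdsWithin] with u hu
    rw [div_le_iff₀ (norm_pos_iff.mpr (sub_ne_zero.mpr (Ne.symm hu)))]
    exact hL v u

/-- Affine isometric actions with linear part `π` correspond exactly to `π`-cocycles
`c : Γ → B` via `α(γ)v = π(γ)v + c(γ)`.  If every such action has a fixed point, then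
the lower bound `C` on the absolute gradient can be chosen independently of the action. -/
theorem stmt4 {B : Type*} [NormedAddCommGroup B] [NormedSpace ℝ B] [CompleteSpace B]
    -- `B` is strictly convex:
    (hB : ∀ v u : B, v ≠ u → ‖v‖ ≤ 1 → ‖u‖ ≤ 1 → ‖v + u‖ < 2)
    {Γ : Type*} [Group Γ] (K : Finset Γ)
    (hKsym : ∀ γ ∈ K, γ⁻¹ ∈ K)
    (hKgen : Subgroup.closure (K : Set Γ) = ⊤)
    (m : Γ → ℝ) (hmpos : ∀ γ ∈ K, 0 < m γ) (hmsum : ∑ γ ∈ K, m γ = 1)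
    -- `π` is a linear isometric action with no nonzero fixed vector:
    (π : Γ →* (B ≃ₗᵢ[ℝ] B)) (hπ : ∀ v : B, (∀ γ : Γ, π γ v = v) → v = 0)
    (r : ℝ) (hr : 1 ≤ r)
    -- every affine isometric action with linear part `π` has a fixed point:
    (hfix : ∀ c : Γ → B, (∀ γ γ' : Γ, c (γ * γ') = π γ (c γ') + c γ) →
      ∃ v : B, ∀ γ : Γ, π γ v + c γ = v) :
    ∃ C > (0 : ℝ), ∀ c : Γ → B, (∀ γ γ' : Γ, c (γ * γ') = π γ (c γ') + c γ) →
      ∀ v : B, 0 < dispR K m (fun γ w => π γ w + c γ) r v →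
        C ≤ absGrad (dispR K m (fun γ w => π γ w + c γ) r) v := by
  have hr0 : 0 < r := by linarith
  have hm : ∀ γ ∈ K, 0 ≤ m γ := fun γ hγ => (hmpos γ hγ).le
  obtain ⟨κ, hκ⟩ := (coboundaryOn K π).antilipschitz_of_injective_of_isClosed_range
    (coboundaryOn_injective K hKgen π hπ) (coboundaryOn_isClosed_range K hKgen π hfix)
  have hKne : K.Nonempty := by
    rw [Finset.nonempty_iff_ne_empty]
    rintro rfl
    simp at hmsum
  obtain ⟨γ₀, hγ₀, hmin⟩ := K.exists_min_image m hKne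
  have hμ : 0 < m γ₀ ^ (1 / r) := Real.rpow_pos_of_pos (hmpos γ₀ hγ₀) _
  set N : B → ℝ := dispR K m (fun γ w => π γ w) r with hN
  have hgap : ∀ w, m γ₀ ^ (1 / r) * ‖w‖ ≤ (κ + 1) * N w := by
    intro w
    have hNw : 0 ≤ N w :=
      (mul_nonneg (norm_nonneg _) hμ.le).trans
        (norm_mul_rpow_le_dispR K m hm (fun γ w => π γ w) hr0 w hγ₀)
    have h1 : ‖coboundaryOn K π w‖ ≤ N w / m γ₀ ^ (1 / r) := by
      refine (pi_norm_le_iff_of_nonneg (by positivity)).mpr fun γ => ?_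
      rw [le_div_iff₀ hμ, coboundaryOn_apply]
      refine le_trans ?_ (norm_mul_rpow_le_dispR K m hm (fun γ w => π γ w) hr0 w γ.2)
      exact mul_le_mul_of_nonneg_left
        (Real.rpow_le_rpow (hm γ₀ hγ₀) (hmin γ γ.2) (by positivity)) (norm_nonneg _)
    have h2 : ‖w‖ ≤ κ * ‖coboundaryOn K π w‖ := by
      simpa [dist_eq_norm] using hκ.le_mul_dist w 0
    rw [le_div_iff₀ hμ] at h1
    calc m γ₀ ^ (1 / r) * ‖w‖ ≤ m γ₀ ^ (1 / r) * (κ * ‖coboundaryOn K π w‖) := by gcongr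
      _ = κ * (‖coboundaryOn K π w‖ * m γ₀ ^ (1 / r)) := by ring
      _ ≤ κ * N w := by gcongr
      _ ≤ (κ + 1) * N w := by gcongr; linarith
  refine ⟨m γ₀ ^ (1 / r) / (κ + 1), by positivity, fun c hc v hv => ?_⟩
  obtain ⟨x, hx⟩ := hfix c hc
  have hFN : ∀ u, dispR K m (fun γ w => π γ w + c γ) r u = N (u - x) := by
    intro u
    simp only [hN, dispR]
    congr 1
    refine Finset.sum_congr rfl fun γ _ => ?_
    rw [map_sub, eq_sub_iff_add_eq'.mpr (hx γ)]
    congr 3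
    abel
  have hsmul : ∀ t : ℝ, 0 ≤ t → ∀ w, N (t • w) = t * N w := fun t ht w =>
    dispR_smul K m hm π hr0 ht w
  have hvx : v ≠ x := by
    rintro rfl
    have h := hsmul 0 le_rfl 0
    rw [hFN, sub_self] at hv
    simp only [smul_zero, zero_mul] at h
    exact hv.ne' h
  refine le_trans ?_ (div_le_absGrad (L := 2) ?_ hvx ?_)
  · rw [div_le_div_iff₀ (by positivity) (norm_pos_iff.mpr (sub_ne_zero.mpr hvx)), hFN,
      mul_comm (N _)]
    exact hgap _
  · intro a b
    rw [hFN, hFN]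
    have h1 := dispR_add_le K m hm π hr (b - x) (a - b)
    have h2 := dispR_le_two_mul_norm K m hm hmsum π hr0 (a - b)
    rw [sub_add_sub_cancel'] at h1
    linarith
  · intro t ht
    rw [hFN, hFN, ← hsmul (1 - t) (by linarith [ht.2])]
    congr 1
    module
end

section
/- Let B be a real Banach space that is strictly convex and smooth, with duality map j. Let Γ be a group generated by a finite symmetric subset K with a symmetric weight m on K, let π be a linear isometric action of Γ on B with no nonzero fixed vector, and let 1 < p < ∞. For v ∈ B write dv(γ) := π(γ)v − v and ‖dv‖_p := (Σ_{γ∈K} ‖dv(γ)‖^p m(γ))^{1/p}. Then the following are equivalent: (1) there is a constant C' > 0 such that every v ∈ B satisfies max_{γ∈K} ‖π(γ)v − v‖ ≥ C'‖v‖; (2) there is a constant C > 0 such that ‖ Σ_{γ∈K} ‖dv(γ)‖^{p−1} m(γ) j(dv(γ)) ‖_{B*} ≥ C‖dv‖_p^{p−1} for all v ∈ B. -/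
open Filter Topology

/-- A weak form of **Ekeland's variational principle** for continuous functions. -/
theorem exists_ekeland_point {X : Type*} [MetricSpace X] [CompleteSpace X] {F : X → ℝ}
    (hF : Continuous F) (hF0 : ∀ x, 0 ≤ F x) {c : ℝ} (hc : 0 < c) (x₀ : X) :
    ∃ x, F x + c * dist x₀ x ≤ F x₀ ∧ ∀ y, F x ≤ F y + c * dist x y := by
  have step (x : X) (n : ℕ) : ∃ y, F y + c * dist x y ≤ F x ∧
      ∀ z, F z + c * dist x z ≤ F x → F y ≤ F z + (1 / 2) ^ n := by
    let T : Set ℝ := F '' {y | F y + c * dist x y ≤ F x}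
    have hne : T.Nonempty := ⟨F x, x, by simp, rfl⟩
    have hbdd : BddBelow T := ⟨0, by rintro _ ⟨y, -, rfl⟩; exact hF0 y⟩
    obtain ⟨_, ⟨y, hy, rfl⟩, hlt⟩ := exists_lt_of_csInf_lt hne
      (lt_add_of_pos_right (sInf T) (show (0 : ℝ) < (1 / 2) ^ n by positivity))
    refine ⟨y, hy, fun z hz => hlt.le.trans ?_⟩
    gcongr
    exact csInf_le hbdd ⟨z, hz, rfl⟩
  choose next hnext hmin using step
  let x : ℕ → X := fun n => Nat.rec x₀ (fun n y => next y n) n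
  have htrans {a b d : X} (hab : F b + c * dist a b ≤ F a) (hbd : F d + c * dist b d ≤ F b) :
      F d + c * dist a d ≤ F a := by
    nlinarith [dist_triangle a b d]
  have hx {n k : ℕ} (hnk : n ≤ k) : F (x k) + c * dist (x n) (x k) ≤ F (x n) := by
    induction k, hnk using Nat.le_induction with
    | base => simp
    | succ k _ ih => exact htrans ih (hnext (x k) k)
  have hanti : Antitone fun n => F (x n) := fun n k hnk => by
    have := hx hnk
    have : 0 ≤ c * dist (x n) (x k) := by positivity
    dsimp only
    linarith
  have hbdd : BddBelow (Set.range fun n => F (x n)) :=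
    ⟨0, by rintro _ ⟨n, rfl⟩; exact hF0 _⟩
  have hL := tendsto_atTop_ciInf hanti hbdd
  set L := ⨅ n, F (x n)
  have hcauchy : CauchySeq x := by
    refine cauchySeq_of_le_tendsto_0' (fun n => (F (x n) - L) / c) (fun n k hnk => ?_) ?_
    · rw [le_div_iff₀ hc]
      have := hx hnk
      have : L ≤ F (x k) := ciInf_le hbdd k
      linarith
    · simpa using (hL.sub_const L).div_const c
  obtain ⟨a, ha⟩ := cauchySeq_tendsto_of_complete hcauchy
  have hFa : Tendsto (fun n => F (x n)) atTop (𝓝 (F a)) := (hF.tendsto a).comp ha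
  have hxa (n : ℕ) : F a + c * dist (x n) a ≤ F (x n) :=
    le_of_tendsto (hFa.add ((tendsto_const_nhds.dist ha).const_mul c))
      ((eventually_ge_atTop n).mono fun _ hk => hx hk)
  refine ⟨a, hxa 0, fun y => ?_⟩
  by_contra! hy
  have hle : F a ≤ F y := by
    have hpow : Tendsto (fun n : ℕ => F y + (1 / 2 : ℝ) ^ n) atTop (𝓝 (F y + 0)) :=
      (tendsto_pow_atTop_nhds_zero_of_lt_one (by norm_num) (by norm_num)).const_add _
    rw [add_zero] at hpow
    exact le_of_tendsto_of_tendsto' (hFa.comp (tendsto_add_atTop_nat 1)) hpow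
      fun n => hmin (x n) n y (htrans (hxa n) hy.le)
  have : 0 ≤ c * dist a y := by positivity
  linarith

/-- The tangent line inequality for `x ↦ x ^ p` on the nonnegative reals. -/
theorem Real.rpow_add_mul_sub_le_rpow {a b p : ℝ} (ha : 0 ≤ a) (hb : 0 ≤ b) (hp : 1 < p) :
    b ^ p + p * b ^ (p - 1) * (a - b) ≤ a ^ p := by
  rcases hb.eq_or_lt with rfl | hb
  · rw [Real.zero_rpow (by linarith), Real.zero_rpow (by linarith)]
    simpa using Real.rpow_nonneg ha p
  · have h := one_add_mul_self_le_rpow_one_add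
      (show -1 ≤ a / b - 1 by linarith [div_nonneg ha hb.le]) hp.le
    rw [add_sub_cancel, Real.div_rpow ha hb.le, le_div_iff₀ (by positivity)] at h
    have hbp : b ^ p = b ^ (p - 1) * b := by
      rw [← Real.rpow_add_one hb.ne', sub_add_cancel]
    calc b ^ p + p * b ^ (p - 1) * (a - b) = (1 + p * (a / b - 1)) * b ^ p := by
          rw [hbp]; field_simp
      _ ≤ a ^ p := h

section DualityMap

variable {B : Type*} [NormedAddCommGroup B] [NormedSpace ℝ B]

/-- `j` sends `0` to `0` and every nonzero vector to its unique support functional. -/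
structure IsDualityMap (j : B → B →L[ℝ] ℝ) : Prop where
  map_zero : j 0 = 0
  norm_eq_one : ∀ v, v ≠ 0 → ‖j v‖ = 1
  apply_self_of_ne : ∀ v, v ≠ 0 → j v v = ‖v‖
  eq_of_support : ∀ v, v ≠ 0 → ∀ f : B →L[ℝ] ℝ, ‖f‖ = 1 → f v = ‖v‖ → f = j v

namespace IsDualityMap

variable {j : B → B →L[ℝ] ℝ}

theorem apply_self (hj : IsDualityMap j) (v : B) : j v v = ‖v‖ := by
  rcases eq_or_ne v 0 with rfl | hv
  · simp
  · exact hj.apply_self_of_ne v hv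

theorem norm_le_one (hj : IsDualityMap j) (v : B) : ‖j v‖ ≤ 1 := by
  rcases eq_or_ne v 0 with rfl | hv
  · simp [hj.map_zero]
  · exact (hj.norm_eq_one v hv).le

theorem abs_apply_le (hj : IsDualityMap j) (v u : B) : |j v u| ≤ ‖u‖ := by
  simpa using (j v).le_of_opNorm_le (hj.norm_le_one v) u

theorem apply_neg_isometry (hj : IsDualityMap j) (e : B ≃ₗᵢ[ℝ] B) (w u : B) :
    j (-(e w)) (e u) = -(j w u) := by
  rcases eq_or_ne w 0 with rfl | hw
  · simp [hj.map_zero]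
  let f : B →L[ℝ] ℝ := -((j w).comp (e.symm.toContinuousLinearEquiv : B →L[ℝ] B))
  have hf : f = j (-(e w)) := by
    refine hj.eq_of_support _ (by simpa using hw) f ?_ ?_
    · rw [norm_neg]
      exact ((j w).opNorm_comp_linearIsometryEquiv e.symm).trans (hj.norm_eq_one w hw)
    · simp [f, hj.apply_self]
  rw [← hf]
  simp [f]

theorem eq_of_norm_le_one (hj : IsDualityMap j) {v : B} (hv : v ≠ 0) {f : B →L[ℝ] ℝ}
    (hf : ‖f‖ ≤ 1) (hfv : f v = ‖v‖) : f = j v := by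
  refine hj.eq_of_support v hv f (hf.antisymm ?_) hfv
  have h := f.le_opNorm v
  rw [hfv, norm_norm] at h
  exact (le_mul_iff_one_le_left (norm_pos_iff.2 hv)).1 h

/-- The duality map is norm-to-weak-star continuous away from `0`. -/
theorem tendsto_apply (hj : IsDualityMap j) {v : B} (hv : v ≠ 0) (u : B) :
    Tendsto (fun w => j w u) (𝓝 v) (𝓝 (j v u)) := by
  have hself : Tendsto (fun w => j w v) (𝓝 v) (𝓝 ‖v‖) := by
    have hsub : Tendsto (fun w => j w (w - v)) (𝓝 v) (𝓝 0) := by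
      refine squeeze_zero_norm (fun w => hj.abs_apply_le w (w - v)) ?_
      exact Continuous.tendsto' (by fun_prop) _ _ (by simp)
    have := (continuous_norm.tendsto v).sub hsub
    simpa [hj.apply_self] using this
  have hlim : Tendsto (fun w => StrongDual.toWeakDual (j w)) (𝓝 v)
      (𝓝 (StrongDual.toWeakDual (j v))) := by
    have hK := WeakDual.isCompact_closedBall (𝕜 := ℝ) (0 : StrongDual ℝ B) 1
    refine hK.tendsto_nhds_of_unique_mapClusterPt
      (Eventually.of_forall fun w => by simpa using hj.norm_le_one w) fun f hf hcl => ?_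
    have hfv : f v = ‖v‖ := by
      have h := hcl.tendsto_comp (WeakDual.eval_continuous (𝕜 := ℝ) v).continuousAt
      exact eq_of_nhds_neBot (ClusterPt.mono h hself)
    exact hj.eq_of_norm_le_one (f := WeakDual.toStrongDual f) hv (by simpa using hf) hfv
  exact ((WeakDual.eval_continuous (𝕜 := ℝ) u).tendsto _).comp hlim

theorem continuous_rpow_mul_apply (hj : IsDualityMap j) {q : ℝ} (hq : 0 < q) (u : B) :
    Continuous fun w => ‖w‖ ^ q * j w u := by
  have hpow : Continuous fun w : B => ‖w‖ ^ q :=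
    continuous_norm.rpow_const fun _ => Or.inr hq.le
  refine continuous_iff_continuousAt.2 fun v => ?_
  rcases eq_or_ne v 0 with rfl | hv
  · have h0 : Tendsto (fun w : B => ‖w‖ ^ q * ‖u‖) (𝓝 0) (𝓝 0) :=
      (hpow.mul_const _).tendsto' _ _ (by simp [Real.zero_rpow hq.ne'])
    simpa [ContinuousAt, hj.map_zero] using squeeze_zero_norm (fun w => by
      rw [norm_mul, Real.norm_of_nonneg (by positivity)]
      exact mul_le_mul_of_nonneg_left (hj.abs_apply_le w u) (by positivity)) h0
  · exact hpow.continuousAt.mul (hj.tendsto_apply hv u)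

/-- `p ‖v‖ ^ (p - 1) j v` is a subgradient of `‖·‖ ^ p` at `v`. -/
theorem rpow_norm_add_le (hj : IsDualityMap j) {p : ℝ} (hp : 1 < p) (v w : B) :
    ‖v‖ ^ p + p * (‖v‖ ^ (p - 1) * j v (w - v)) ≤ ‖w‖ ^ p := by
  refine le_trans ?_ (Real.rpow_add_mul_sub_le_rpow (norm_nonneg w) (norm_nonneg v) hp)
  have h : j v (w - v) ≤ ‖w‖ - ‖v‖ := by
    rw [map_sub, hj.apply_self]
    linarith [le_of_abs_le (hj.abs_apply_le v w)]
  rw [mul_assoc]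
  gcongr

variable {Γ : Type*} [Group Γ] {K : Finset Γ} {m : Γ → ℝ}

theorem sum_apply_displacement (hj : IsDualityMap j) (hKsym : ∀ γ ∈ K, γ⁻¹ ∈ K)
    (hmsym : ∀ γ ∈ K, m γ = m γ⁻¹) (π : Γ →* (B ≃ₗᵢ[ℝ] B)) (q : ℝ) (w u : B) :
    ∑ γ ∈ K, ‖π γ w - w‖ ^ q * m γ * j (π γ w - w) (π γ u - u) =
      -2 * (∑ γ ∈ K, (‖π γ w - w‖ ^ q * m γ) • j (π γ w - w)) u := by
  have hinv (γ : Γ) (x : B) : π γ (π γ⁻¹ x) = x := by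
    change (π γ * π γ⁻¹) x = x
    rw [← map_mul]
    simp
  have hd (γ : Γ) : π γ w - w = -(π γ (π γ⁻¹ w - w)) := by
    rw [map_sub, hinv, neg_sub]
  have hswap : ∑ γ ∈ K, ‖π γ w - w‖ ^ q * m γ * j (π γ w - w) (π γ u) =
      ∑ γ ∈ K, -(‖π γ w - w‖ ^ q * m γ * j (π γ w - w) u) := by
    refine Finset.sum_nbij' (·⁻¹) (·⁻¹) hKsym hKsym (by simp) (by simp) fun γ hγ => ?_
    rw [← hmsym γ hγ, hd γ, hj.apply_neg_isometry, norm_neg, LinearIsometryEquiv.norm_map]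
    ring
  simp only [map_sub, mul_sub, Finset.sum_sub_distrib] at hswap ⊢
  rw [hswap]
  simp only [sum_apply, smul_apply, smul_eq_mul, Finset.sum_neg_distrib]
  ring

end IsDualityMap

end DualityMap

theorem stmt17 {B : Type*} [NormedAddCommGroup B] [NormedSpace ℝ B] [CompleteSpace B]
    -- `B` is strictly convex:
    (hB : ∀ v u : B, v ≠ u → ‖v‖ ≤ 1 → ‖u‖ ≤ 1 → ‖v + u‖ < 2)
    -- `B` is smooth, with duality map `j`:
    (j : B → (B →L[ℝ] ℝ)) (hj0 : j 0 = 0)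
    (hjn : ∀ v : B, v ≠ 0 → ‖j v‖ = 1)
    (hjv : ∀ v : B, v ≠ 0 → j v v = ‖v‖)
    (hjuniq : ∀ v : B, v ≠ 0 → ∀ f : B →L[ℝ] ℝ, ‖f‖ = 1 → f v = ‖v‖ → f = j v)
    {Γ : Type*} [Group Γ] (K : Finset Γ) (hKne : K.Nonempty)
    (hKsym : ∀ γ ∈ K, γ⁻¹ ∈ K)
    (hKgen : Subgroup.closure (K : Set Γ) = ⊤)
    -- `m` is a symmetric weight on `K`:
    (m : Γ → ℝ) (hmpos : ∀ γ ∈ K, 0 < m γ) (hmsym : ∀ γ ∈ K, m γ = m γ⁻¹)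
    (hmsum : ∑ γ ∈ K, m γ = 1)
    -- `π` is a linear isometric action with no nonzero fixed vector:
    (π : Γ →* (B ≃ₗᵢ[ℝ] B)) (hπ : ∀ v : B, (∀ γ : Γ, π γ v = v) → v = 0)
    (p : ℝ) (hp : 1 < p) :
    (∃ C' > (0 : ℝ), ∀ v : B, C' * ‖v‖ ≤ K.sup' hKne fun γ => ‖π γ v - v‖) ↔
      (∃ C > (0 : ℝ), ∀ v : B,
        C * ((∑ γ ∈ K, ‖π γ v - v‖ ^ p * m γ) ^ (1 / p)) ^ (p - 1) ≤
          ‖∑ γ ∈ K, (‖π γ v - v‖ ^ (p - 1) * m γ) • j (π γ v - v)‖) := by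
  have hj : IsDualityMap j := ⟨hj0, hjn, hjv, hjuniq⟩
  have hp0 : 0 < p := by linarith
  set F : B → ℝ := fun v => (∑ γ ∈ K, ‖π γ v - v‖ ^ p * m γ) ^ (1 / p) with hFdef
  set A : B → B →L[ℝ] ℝ :=
    fun v => ∑ γ ∈ K, (‖π γ v - v‖ ^ (p - 1) * m γ) • j (π γ v - v) with hAdef
  have hterm (v : B) : ∀ γ ∈ K, 0 ≤ ‖π γ v - v‖ ^ p * m γ := fun γ hγ => by
    have := hmpos γ hγ
    positivity
  have hF0 (v : B) : 0 ≤ F v := Real.rpow_nonneg (Finset.sum_nonneg (hterm v)) _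
  have hFp (v : B) : F v ^ p = ∑ γ ∈ K, ‖π γ v - v‖ ^ p * m γ := by
    rw [hFdef]
    dsimp only
    rw [← Real.rpow_mul (Finset.sum_nonneg (hterm v)), one_div_mul_cancel hp0.ne',
      Real.rpow_one]
  have hA (w u : B) :
      ∑ γ ∈ K, ‖π γ w - w‖ ^ (p - 1) * m γ * j (π γ w - w) (π γ u - u) = -2 * A w u :=
    hj.sum_apply_displacement hKsym hmsym π (p - 1) w u
  change _ ↔ ∃ C > (0 : ℝ), ∀ v : B, C * F v ^ (p - 1) ≤ ‖A v‖
  constructor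
  · rintro ⟨C', hC', h⟩
    obtain ⟨γ₀, hγ₀, hmin⟩ := K.exists_min_image m hKne
    set μ := m γ₀ ^ (1 / p)
    have hμ : 0 < μ := Real.rpow_pos_of_pos (hmpos γ₀ hγ₀) _
    have hle (v : B) : C' * μ * ‖v‖ ≤ F v := by
      obtain ⟨γ, hγ, hmax⟩ := K.exists_mem_eq_sup' hKne fun γ => ‖π γ v - v‖
      have h1 := h v
      rw [hmax] at h1
      calc C' * μ * ‖v‖ = C' * ‖v‖ * μ := by ring
        _ ≤ ‖π γ v - v‖ * m γ ^ (1 / p) := by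
            have := (hmpos γ₀ hγ₀).le
            exact mul_le_mul h1 (Real.rpow_le_rpow this (hmin γ hγ) (by positivity)) hμ.le
              (norm_nonneg _)
        _ = (‖π γ v - v‖ ^ p * m γ) ^ (1 / p) := by
            rw [Real.mul_rpow (by positivity) (hmpos γ hγ).le,
              ← Real.rpow_mul (norm_nonneg _), mul_one_div_cancel hp0.ne', Real.rpow_one]
        _ ≤ F v := by
            refine Real.rpow_le_rpow (hterm v γ hγ) ?_ (by positivity)
            exact Finset.single_le_sum (f := fun γ => ‖π γ v - v‖ ^ p * m γ) (hterm v) hγ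
    have hE (v : B) : F v ^ p = -2 * A v v := by
      rw [hFp, ← hA]
      refine Finset.sum_congr rfl fun γ _ => ?_
      rw [hj.apply_self, mul_right_comm, ← Real.rpow_add_one' (norm_nonneg _) (by linarith),
        sub_add_cancel]
    refine ⟨C' * μ / 2, by positivity, fun v => ?_⟩
    rcases eq_or_ne v 0 with rfl | hv
    · have : F 0 = 0 := by
        simp [hFdef, Real.zero_rpow hp0.ne', Real.zero_rpow (inv_ne_zero hp0.ne')]
      rw [this, Real.zero_rpow (by linarith)]
      simp
    · have hvpos : 0 < ‖v‖ := norm_pos_iff.2 hv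
      have h1 : F v ^ p = F v ^ (p - 1) * F v := by
        rw [← Real.rpow_add_one' (hF0 v) (by linarith), sub_add_cancel]
      have h2 : -(A v v) ≤ ‖A v‖ * ‖v‖ := (neg_le_abs _).trans ((A v).le_opNorm v)
      have h3 := mul_le_mul_of_nonneg_left (hle v) (Real.rpow_nonneg (hF0 v) (p - 1))
      have h4 := hE v
      refine le_of_mul_le_mul_right ?_ hvpos
      linarith
  · rintro ⟨C, hC, h⟩
    have hFcont : Continuous F := by
      have hsum : Continuous fun v => ∑ γ ∈ K, ‖π γ v - v‖ ^ p * m γ := by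
        refine continuous_finsetSum _ fun γ _ => Continuous.mul_const ?_ _
        exact (((π γ).continuous.sub continuous_id).norm).rpow_const fun _ => Or.inr hp0.le
      exact hsum.rpow_const fun _ => Or.inr (by positivity)
    have hAcont (u : B) : Continuous fun w => A w u := by
      simp only [hAdef, sum_apply, smul_apply, smul_eq_mul]
      refine continuous_finsetSum _ fun γ _ => ?_
      have := ((hj.continuous_rpow_mul_apply (show 0 < p - 1 by linarith) u).comp
        ((π γ).continuous.sub continuous_id)).const_mul (m γ)
      refine this.congr fun w => ?_
      simp only [Function.comp_apply, Pi.sub_apply, id_eq]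
      ring
    have hsub (v w : B) : F w ^ p - F v ^ p ≤ p * (2 * A w (v - w)) := by
      have : F w ^ p + p * (-2 * A w (v - w)) ≤ F v ^ p := by
        rw [hFp, hFp, ← hA, Finset.mul_sum, ← Finset.sum_add_distrib]
        refine Finset.sum_le_sum fun γ hγ => ?_
        have h1 := mul_le_mul_of_nonneg_right
          (hj.rpow_norm_add_le hp (π γ w - w) (π γ v - v)) (hmpos γ hγ).le
        rw [show π γ (v - w) - (v - w) = π γ v - v - (π γ w - w) by rw [map_sub]; abel]
        linarith
      linarith
    have hcrit (v : B) (hv : ∀ w, F v ≤ F w + C * dist v w) : v = 0 := by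
      have hbound (u : B) : 2 * A v u ≤ C * F v ^ (p - 1) * ‖u‖ := by
        have hpt (t : ℝ) (ht : 0 < t) : 2 * A (v + t • u) u ≤ C * F v ^ (p - 1) * ‖u‖ := by
          have h1 := hsub v (v + t • u)
          have h2 := Real.rpow_add_mul_sub_le_rpow (hF0 (v + t • u)) (hF0 v) hp
          have h3 := hv (v + t • u)
          rw [dist_self_add_right, norm_smul, Real.norm_of_nonneg ht.le] at h3
          have h4 : 0 ≤ p * F v ^ (p - 1) := mul_nonneg hp0.le (Real.rpow_nonneg (hF0 v) _)
          have h5 := mul_le_mul_of_nonneg_left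
            (show -(C * (t * ‖u‖)) ≤ F (v + t • u) - F v by linarith) h4
          rw [sub_add_cancel_left, map_neg, map_smul, smul_eq_mul] at h1
          refine le_of_mul_le_mul_left ?_ (mul_pos hp0 ht)
          linarith
        have hlim : Tendsto (fun t : ℝ => 2 * A (v + t • u) u) (𝓝[>] 0) (𝓝 (2 * A v u)) := by
          have hc : Continuous fun t : ℝ => 2 * A (v + t • u) u :=
            ((hAcont u).comp (by fun_prop : Continuous fun t : ℝ => v + t • u)).const_mul 2
          exact (hc.tendsto' 0 _ (by simp)).mono_left nhdsWithin_le_nhds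
        exact le_of_tendsto hlim (eventually_mem_nhdsWithin.mono hpt)
      have hpow : 0 ≤ F v ^ (p - 1) := Real.rpow_nonneg (hF0 v) _
      have hnorm : ‖A v‖ ≤ C * F v ^ (p - 1) / 2 := by
        refine (A v).opNorm_le_bound (by positivity) fun u => abs_le.2 ⟨?_, ?_⟩
        · have := hbound (-u)
          rw [map_neg, norm_neg] at this
          linarith
        · linarith [hbound u]
      have hCF : C * F v ^ (p - 1) = 0 := by
        have := h v
        have : 0 ≤ C * F v ^ (p - 1) := by positivity
        linarith
      have hFv : F v = 0 := by
        have h1 := (mul_eq_zero.1 hCF).resolve_left hC.ne'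
        exact ((Real.rpow_eq_zero_iff_of_nonneg (hF0 v)).1 h1).1
      have hK : ∀ γ ∈ K, π γ v = v := fun γ hγ => by
        have h1 := hFp v
        rw [hFv, Real.zero_rpow hp0.ne', eq_comm, Finset.sum_eq_zero_iff_of_nonneg (hterm v)]
          at h1
        have h2 := (mul_eq_zero.1 (h1 γ hγ)).resolve_right (hmpos γ hγ).ne'
        exact sub_eq_zero.1
          (norm_eq_zero.1 ((Real.rpow_eq_zero_iff_of_nonneg (norm_nonneg _)).1 h2).1)
      refine hπ v fun γ => ?_
      have hγ : γ ∈ Subgroup.closure (K : Set Γ) := hKgen ▸ Subgroup.mem_top γ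
      induction hγ using Subgroup.closure_induction with
      | mem γ hγ => exact hK γ hγ
      | one => simp
      | mul a b _ _ ha hb => rw [map_mul, LinearIsometryEquiv.coe_mul, Function.comp_apply, hb, ha]
      | inv a _ ha =>
        conv_lhs => rw [← ha]
        change (π a⁻¹ * π a) v = v
        rw [← map_mul]
        simp
    refine ⟨C, hC, fun v₀ => ?_⟩
    obtain ⟨v, hv, hmin⟩ := exists_ekeland_point hFcont hF0 hC v₀
    obtain rfl := hcrit v hmin
    have hCv : C * ‖v₀‖ ≤ F v₀ := by
      rw [dist_zero_right] at hv
      linarith [hF0 0]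
    refine hCv.trans ?_
    set M := K.sup' hKne fun γ => ‖π γ v₀ - v₀‖
    have hM (γ : Γ) (hγ : γ ∈ K) : ‖π γ v₀ - v₀‖ ≤ M :=
      K.le_sup' (fun γ => ‖π γ v₀ - v₀‖) hγ
    have hM0 : 0 ≤ M := (norm_nonneg _).trans (hM _ hKne.choose_spec)
    refine (Real.rpow_le_rpow_iff (hF0 v₀) hM0 hp0).1 ?_
    calc F v₀ ^ p = ∑ γ ∈ K, ‖π γ v₀ - v₀‖ ^ p * m γ := hFp v₀
      _ ≤ ∑ γ ∈ K, M ^ p * m γ := Finset.sum_le_sum fun γ hγ => by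
          have := (hmpos γ hγ).le
          have := hM γ hγ
          gcongr
      _ = M ^ p := by rw [← Finset.mul_sum, hmsum, mul_one]
end
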